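/- Let μ, p, q be probability measures on ℝ^D, each with finite first moment, and let t ∈ (0,1). Then for every x ∈ ℝ^D, the guided vector field admits the posterior-expectation form: x/t + ((1−t)/t)·(∇_x log μ_t(x) + ∇_x log(q_t(x)/p_t(x))) = (m_t^{μ}(x) − x)/(1−t) + (1/(1−t))·(m_t^{q}(x) − m_t^{p}(x)), where μ_t, p_t, q_t are the Gaussian-smoothed marginal densities and m_t^{μ}, m_t^{p}, m_t^{q} the corresponding posterior means. (Equality of the guided flows in Equations (6) and (7).) -/

import Mathlib

open MeasureTheory Real Filter Topology

/-- The Gaussian kernel `G_t(x, y) = exp(−‖x − t·y‖²/(2(1−t)²))`. -/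
noncomputable def gaussKernel {D : ℕ} (t : ℝ) (x y : EuclideanSpace ℝ (Fin D)) : ℝ :=
  Real.exp (-‖x - t • y‖ ^ 2 / (2 * (1 - t) ^ 2))

/-- The posterior mean `m_t^p(x) = (∫ y·G_t(x,y) dp(y)) / (∫ G_t(x,y) dp(y))`. -/
noncomputable def postMean {D : ℕ} (p : Measure (EuclideanSpace ℝ (Fin D))) (t : ℝ)
    (x : EuclideanSpace ℝ (Fin D)) : EuclideanSpace ℝ (Fin D) :=
  (∫ y, gaussKernel t x y ∂p)⁻¹ • ∫ y, gaussKernel t x y • y ∂p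

/-- The Gaussian-smoothed marginal density
`p_t(x) = (2π(1−t)²)^{−D/2} ∫ G_t(x,y) dp(y)`. -/
noncomputable def marginalDensity {D : ℕ} (p : Measure (EuclideanSpace ℝ (Fin D))) (t : ℝ)
    (x : EuclideanSpace ℝ (Fin D)) : ℝ :=
  (2 * Real.pi * (1 - t) ^ 2) ^ (-(D : ℝ) / 2) * ∫ y, gaussKernel t x y ∂p

section GaussKernel

variable {D : ℕ}

theorem gaussKernel_pos (t : ℝ) (x y : EuclideanSpace ℝ (Fin D)) : 0 < gaussKernel t x y :=
  Real.exp_pos _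

theorem gaussKernel_le_one (t : ℝ) (x y : EuclideanSpace ℝ (Fin D)) : gaussKernel t x y ≤ 1 := by
  rw [gaussKernel, Real.exp_le_one_iff]
  exact div_nonpos_of_nonpos_of_nonneg (by simp) (by positivity)

theorem continuous_gaussKernel (t : ℝ) (x : EuclideanSpace ℝ (Fin D)) :
    Continuous (gaussKernel t x) := by
  unfold gaussKernel
  fun_prop

theorem hasGradientAt_gaussKernel (t : ℝ) (x y : EuclideanSpace ℝ (Fin D)) :
    HasGradientAt (fun x' => gaussKernel t x' y)
      (-((1 - t) ^ 2)⁻¹ • gaussKernel t x y • (x - t • y)) x := by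
  rw [hasGradientAt_iff_hasFDerivAt]
  have h := ((((hasFDerivAt_id x).sub_const (t • y)).norm_sq.neg).mul_const
    (2 * (1 - t) ^ 2)⁻¹).exp
  refine h.congr_fderiv ?_
  ext v
  simp [gaussKernel, div_eq_mul_inv]
  ring

theorem integrable_gaussKernel_smul {p : Measure (EuclideanSpace ℝ (Fin D))} (t : ℝ)
    (x : EuclideanSpace ℝ (Fin D)) (hp : Integrable (fun y => ‖y‖) p) :
    Integrable (fun y => gaussKernel t x y • y) p :=
  ((integrable_norm_iff continuous_id.aestronglyMeasurable).1 hp).bdd_smul 1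
    (continuous_gaussKernel t x).aestronglyMeasurable <| .of_forall fun y => by
      rw [Real.norm_of_nonneg (gaussKernel_pos t x y).le]
      exact gaussKernel_le_one t x y

variable (p : Measure (EuclideanSpace ℝ (Fin D))) [IsProbabilityMeasure p]
  (t : ℝ) (x : EuclideanSpace ℝ (Fin D))

theorem integrable_gaussKernel : Integrable (gaussKernel t x) p :=
  .of_bound (continuous_gaussKernel t x).aestronglyMeasurable 1 <| .of_forall fun y => by
    rw [Real.norm_of_nonneg (gaussKernel_pos t x y).le]
    exact gaussKernel_le_one t x y

theorem integral_gaussKernel_pos : 0 < ∫ y, gaussKernel t x y ∂p := by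
  rw [integral_pos_iff_support_of_nonneg (fun y => (gaussKernel_pos t x y).le)
    (integrable_gaussKernel p t x)]
  have h : Function.support (gaussKernel t x) = Set.univ :=
    Set.eq_univ_of_forall fun y => (gaussKernel_pos t x y).ne'
  simp [h]

variable {p}

theorem integral_gaussKernel_smul_sub (hp : Integrable (fun y => ‖y‖) p) :
    ∫ y, gaussKernel t x y • (x - t • y) ∂p
      = (∫ y, gaussKernel t x y ∂p) • (x - t • postMean p t x) := by
  simp_rw [smul_sub, smul_comm _ t]
  have h : Integrable (fun y => t • gaussKernel t x y • y) p :=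
    (integrable_gaussKernel_smul t x hp).smul t
  rw [integral_sub ((integrable_gaussKernel p t x).smul_const x) h, integral_smul_const,
    integral_smul, postMean, smul_inv_smul₀ (integral_gaussKernel_pos p t x).ne']

/-- Differentiation under the integral sign for the Gaussian smoothing of `p`. -/
theorem hasGradientAt_integral_gaussKernel (hp : Integrable (fun y => ‖y‖) p) :
    HasGradientAt (fun x' => ∫ y, gaussKernel t x' y ∂p)
      (-((1 - t) ^ 2)⁻¹ • (∫ y, gaussKernel t x y ∂p) • (x - t • postMean p t x)) x := by
  let F' (x' y : EuclideanSpace ℝ (Fin D)) : EuclideanSpace ℝ (Fin D) :=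
    -((1 - t) ^ 2)⁻¹ • gaussKernel t x' y • (x' - t • y)
  have hF'_cont : Continuous (F' x) := by
    have := continuous_gaussKernel t x
    fun_prop
  have hF'_bound (y x' : EuclideanSpace ℝ (Fin D)) (hx' : x' ∈ Metric.ball x 1) :
      ‖F' x' y‖ ≤ ((1 - t) ^ 2)⁻¹ * (‖x‖ + 1 + |t| * ‖y‖) := by
    have hx : ‖x'‖ ≤ ‖x‖ + 1 := by
      have h := norm_le_norm_add_norm_sub x x'
      rw [← dist_eq_norm'] at h
      linarith [Metric.mem_ball.1 hx']
    have hsub : ‖x' - t • y‖ ≤ ‖x‖ + 1 + |t| * ‖y‖ := by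
      refine (norm_sub_le _ _).trans ?_
      rw [norm_smul, Real.norm_eq_abs]
      gcongr
    simp only [F', norm_smul, norm_neg]
    rw [Real.norm_of_nonneg (gaussKernel_pos t x' y).le, Real.norm_of_nonneg (by positivity)]
    gcongr
    exact (mul_le_of_le_one_left (norm_nonneg _) (gaussKernel_le_one t x' y)).trans hsub
  have hbound : Integrable (fun y : EuclideanSpace ℝ (Fin D) =>
      ((1 - t) ^ 2)⁻¹ * (‖x‖ + 1 + |t| * ‖y‖)) p :=
    ((integrable_const _).add (hp.const_mul _)).const_mul _
  have hF'_int : Integrable (F' x) p :=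
    hbound.mono' hF'_cont.aestronglyMeasurable <| .of_forall fun y =>
      hF'_bound y x (Metric.mem_ball_self one_pos)
  have hdual_cont : Continuous fun y =>
      InnerProductSpace.toDual ℝ (EuclideanSpace ℝ (Fin D)) (F' x y) :=
    (InnerProductSpace.toDual ℝ (EuclideanSpace ℝ (Fin D))).continuous.comp hF'_cont
  have hdual_int : Integrable (fun y =>
      InnerProductSpace.toDual ℝ (EuclideanSpace ℝ (Fin D)) (F' x y)) p :=
    hF'_int.mono hdual_cont.aestronglyMeasurable (.of_forall fun y => by simp)
  have key := hasFDerivAt_integral_of_dominated_of_fderiv_le (μ := p) (𝕜 := ℝ)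
    (F := gaussKernel t)
    (F' := fun x' y => InnerProductSpace.toDual ℝ (EuclideanSpace ℝ (Fin D)) (F' x' y))
    (Metric.ball_mem_nhds x one_pos)
    (.of_forall fun x' => (continuous_gaussKernel t x').aestronglyMeasurable)
    (integrable_gaussKernel p t x) hdual_cont.aestronglyMeasurable
    (.of_forall fun y x' hx' => by simpa using hF'_bound y x' hx') hbound
    (.of_forall fun y x' _ => (hasGradientAt_gaussKernel t x' y).hasFDerivAt)
  rw [hasGradientAt_iff_hasFDerivAt]
  refine key.congr_fderiv ?_
  rw [← integral_gaussKernel_smul_sub t x hp, ← integral_smul]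
  ext v
  rw [ContinuousLinearMap.integral_apply hdual_int]
  simp only [InnerProductSpace.toDual_apply_apply]
  simp_rw [real_inner_comm v]
  exact integral_inner hF'_int v

variable {t}

theorem marginalDensity_pos (p : Measure (EuclideanSpace ℝ (Fin D))) [IsProbabilityMeasure p]
    (ht : t ≠ 1) : 0 < marginalDensity p t x := by
  have h : 0 < (1 - t) ^ 2 := sq_pos_of_ne_zero (sub_ne_zero.2 ht.symm)
  exact mul_pos (Real.rpow_pos_of_pos (by positivity) _) (integral_gaussKernel_pos p t x)

/-- Tweedie's formula for the score of the smoothed density. -/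
theorem hasGradientAt_log_marginalDensity (hp : Integrable (fun y => ‖y‖) p) (ht : t ≠ 1) :
    HasGradientAt (fun x' => Real.log (marginalDensity p t x'))
      (((1 - t) ^ 2)⁻¹ • (t • postMean p t x - x)) x := by
  have h := (((hasGradientAt_integral_gaussKernel t x hp).hasFDerivAt).const_mul
    ((2 * Real.pi * (1 - t) ^ 2) ^ (-(D : ℝ) / 2))).log (marginalDensity_pos x p ht).ne'
  rw [hasGradientAt_iff_hasFDerivAt]
  refine h.congr_fderiv ?_
  have hne := (marginalDensity_pos x p ht).ne'
  rw [marginalDensity] at hne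
  obtain ⟨hc, hZ⟩ := mul_ne_zero_iff.1 hne
  ext v
  simp only [smul_apply, InnerProductSpace.toDual_apply_apply,
    inner_smul_left, inner_sub_left, smul_eq_mul, conj_trivial]
  field_simp
  ring

theorem hasGradientAt_log_marginalDensity_div {q : Measure (EuclideanSpace ℝ (Fin D))}
    [IsProbabilityMeasure q] (hq : Integrable (fun y => ‖y‖) q)
    (hp : Integrable (fun y => ‖y‖) p) (ht : t ≠ 1) :
    HasGradientAt (fun x' => Real.log (marginalDensity q t x' / marginalDensity p t x'))
      (((1 - t) ^ 2)⁻¹ • t • (postMean q t x - postMean p t x)) x := by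
  simp_rw [fun x' => Real.log_div (marginalDensity_pos x' q ht).ne'
    (marginalDensity_pos x' p ht).ne']
  rw [hasGradientAt_iff_hasFDerivAt]
  refine ((hasGradientAt_log_marginalDensity x hq ht).hasFDerivAt.sub
    (hasGradientAt_log_marginalDensity x hp ht).hasFDerivAt).congr_fderiv ?_
  rw [← map_sub]
  congr 1
  module

end GaussKernel

/-- Equality of the guided flows in Equations (6) and (7): the guided vector field admits
the posterior-expectation form. -/
theorem guidedFlow_eq_postMean_form
    (D : ℕ) (μ p q : Measure (EuclideanSpace ℝ (Fin D)))
    [IsProbabilityMeasure μ] [IsProbabilityMeasure p] [IsProbabilityMeasure q]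
    (hμ : Integrable (fun y => ‖y‖) μ)
    (hp : Integrable (fun y => ‖y‖) p)
    (hq : Integrable (fun y => ‖y‖) q)
    (t : ℝ) (ht : t ∈ Set.Ioo (0 : ℝ) 1)
    (x : EuclideanSpace ℝ (Fin D)) :
    t⁻¹ • x + ((1 - t) / t) •
        (gradient (fun x' => Real.log (marginalDensity μ t x')) x
          + gradient (fun x' => Real.log (marginalDensity q t x' / marginalDensity p t x')) x)
      = (1 - t)⁻¹ • (postMean μ t x - x)
          + (1 - t)⁻¹ • (postMean q t x - postMean p t x) := by
  have ht0 : t ≠ 0 := ht.1.ne'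
  have ht1 : t ≠ 1 := ht.2.ne
  have h1t : 1 - t ≠ 0 := sub_ne_zero.2 ht1.symm
  rw [(hasGradientAt_log_marginalDensity x hμ ht1).gradient,
    (hasGradientAt_log_marginalDensity_div x hq hp ht1).gradient]
  match_scalars <;> field_simp
  ring
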